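/- arXiv:2411.07661 — 2 statements merged into one kernel-verified Lean document; each statement's English description precedes it below -/
import Mathlib

section
/- Suppose y^n satisfies the optimality condition ∇H^n(y^n) − ∇F^n(u^n) + M(y^n − u^n) = 0, λ_n ≥ 0 satisfies the descent condition E^n(y^n + λ_n d^n) ≤ E^n(y^n) − α λ_n ‖d^n‖² with d^n = y^n − u^n and α > 0, and u^{n+1} = y^n + λ_n d^n. Then with A(x,y) = E(x) + (L/2 + 1/(3δt))‖x − y‖², one has ((α λ_n + 4/(3δt) − L/2)/(1 + λ_n)² − L)‖u^{n+1} − u^n‖² ≤ A(u^n, u^{n−1}) − A(u^{n+1}, u^n). -/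
open scoped RealInnerProductSpace

theorem hasFDerivAt_norm_sub_sq {X : Type*} [NormedAddCommGroup X] [InnerProductSpace ℝ X]
    (a x : X) :
    HasFDerivAt (fun u : X => ‖u - a‖ ^ 2) (2 • innerSL ℝ (x - a)) x := by
  simpa using ((hasFDerivAt_id x).sub_const a).norm_sq

section GradientInequalities

variable {X : Type*} [NormedAddCommGroup X] [InnerProductSpace ℝ X] [CompleteSpace X]

theorem HasGradientAt.hasDerivAt_comp_lineMap {G : X → ℝ} {g x y : X} {t : ℝ}
    (hG : HasGradientAt G g (AffineMap.lineMap x y t)) :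
    HasDerivAt (fun s : ℝ => G (AffineMap.lineMap x y s)) ⟪g, y - x⟫ t := by
  simpa [Function.comp_def] using hG.hasFDerivAt.comp_hasDerivAt t AffineMap.hasDerivAt_lineMap

theorem ConvexOn.add_inner_le_of_hasGradientAt {G : X → ℝ} (hconv : ConvexOn ℝ Set.univ G)
    {g x : X} (hG : HasGradientAt G g x) (y : X) : G x + ⟪g, y - x⟫ ≤ G y := by
  have hline : ConvexOn ℝ Set.univ (fun s : ℝ => G (AffineMap.lineMap x y s)) :=
    hconv.comp_affineMap (AffineMap.lineMap x y : ℝ →ᵃ[ℝ] X)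
  have hderiv : HasDerivAt (fun s : ℝ => G (AffineMap.lineMap x y s)) ⟪g, y - x⟫ 0 :=
    HasGradientAt.hasDerivAt_comp_lineMap (by simpa using hG)
  have hslope := hline.le_slope_of_hasDerivAt (Set.mem_univ 0) (Set.mem_univ 1) one_pos hderiv
  simp [slope_def_field] at hslope
  linarith

/-- The descent lemma for a function with `L`-Lipschitz gradient. -/
theorem le_add_inner_add_of_lipschitz_gradient {G : X → ℝ} {g : X → X} {L : ℝ}
    (hG : ∀ x, HasGradientAt G (g x) x) (hLip : ∀ x y, ‖g x - g y‖ ≤ L * ‖x - y‖) (x y : X) :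
    G y ≤ G x + ⟪g x, y - x⟫ + L / 2 * ‖y - x‖ ^ 2 := by
  have hderiv (t : ℝ) : HasDerivAt
      (fun s : ℝ => G (AffineMap.lineMap x y s) - s * ⟪g x, y - x⟫ - L / 2 * ‖y - x‖ ^ 2 * s ^ 2)
      (⟪g (AffineMap.lineMap x y t), y - x⟫ - 1 * ⟪g x, y - x⟫
        - L / 2 * ‖y - x‖ ^ 2 * (2 * t)) t := by
    simpa using ((hG _).hasDerivAt_comp_lineMap.fun_sub ((hasDerivAt_id t).mul_const _)).fun_sub
      ((hasDerivAt_pow 2 t).const_mul (L / 2 * ‖y - x‖ ^ 2))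
  have hanti := antitoneOn_of_deriv_nonpos (convex_Icc (0 : ℝ) 1)
    (fun t _ => (hderiv t).continuousAt.continuousWithinAt)
    (fun t _ => (hderiv t).differentiableAt.differentiableWithinAt) fun t ht => by
      rw [interior_Icc] at ht
      rw [(hderiv t).deriv, one_mul, ← inner_sub_left]
      have hnorm : ‖g (AffineMap.lineMap x y t) - g x‖ ≤ L * (t * ‖y - x‖) := by
        simpa [AffineMap.lineMap_apply, norm_smul, abs_of_pos ht.1]
          using hLip (AffineMap.lineMap x y t) x
      have hinner := real_inner_le_norm (g (AffineMap.lineMap x y t) - g x) (y - x)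
      have hmul := mul_le_mul_of_nonneg_right hnorm (norm_nonneg (y - x))
      linarith
  have hle := hanti (Set.left_mem_Icc.2 zero_le_one) (Set.right_mem_Icc.2 zero_le_one) zero_le_one
  simp at hle
  linarith

end GradientInequalities

/-- One-step decrease of the auxiliary function
`A(x,y) = E(x) + (L/2 + 1/(3δt))‖x - y‖²` along the line-search update
`uⁿ⁺¹ = yⁿ + λₙ dⁿ`. -/
theorem auxiliary_function_decrease_un
    {X : Type*} [NormedAddCommGroup X] [InnerProductSpace ℝ X] [FiniteDimensional ℝ X]
    (H : X → ℝ) (h : X → X) (hH : ∀ x : X, HasGradientAt H (h x) x)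
    (hHconv : ConvexOn ℝ Set.univ H)
    (F : X → ℝ) (f : X → X) (hF : ∀ x : X, HasGradientAt F (f x) x)
    (L : ℝ) (hL : 0 < L) (hLip : ∀ x y : X, ‖f x - f y‖ ≤ L * ‖x - y‖)
    (δt : ℝ) (hδt : 0 < δt) (hδt2 : δt < 2 / (3 * L))
    (M : X →L[ℝ] X) (hMsym : ∀ x y : X, ⟪M x, y⟫ = ⟪x, M y⟫)
    (hMpsd : ∀ x : X, 0 ≤ ⟪M x, x⟫)
    (un unm1 : X)
    (Hn Fn En : X → ℝ)
    (hHn : ∀ u : X, Hn u = H u + (1 / δt) * ‖u - un‖ ^ 2)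
    (hFn : ∀ u : X, Fn u = (1 / (3 * δt)) * ‖u - unm1‖ ^ 2 - F u
      - ⟪f un - f unm1, u - unm1⟫)
    (hEn : ∀ u : X, En u = Hn u - Fn u)
    (E : X → ℝ) (hE : ∀ u : X, E u = H u + F u)
    (Afun : X → X → ℝ)
    (hAfun : ∀ x y : X, Afun x y = E x + (L / 2 + 1 / (3 * δt)) * ‖x - y‖ ^ 2)
    (yn : X)
    (hopt : gradient Hn yn - gradient Fn un + M (yn - un) = 0)
    (α lamn : ℝ) (hα : 0 < α) (hlamn : 0 ≤ lamn)
    (hls : En (yn + lamn • (yn - un)) ≤ En yn - α * lamn * ‖yn - un‖ ^ 2)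
    (unp1 : X) (hupd : unp1 = yn + lamn • (yn - un)) :
    ((α * lamn + 4 / (3 * δt) - L / 2) / (1 + lamn) ^ 2 - L) * ‖unp1 - un‖ ^ 2
      ≤ Afun un unm1 - Afun unp1 un := by
  obtain ⟨d, rfl⟩ : ∃ d, yn = un + d := ⟨yn - un, by simp⟩
  obtain ⟨s, rfl⟩ : ∃ s, un = unm1 + s := ⟨un - unm1, by simp⟩
  set w := unm1
  set g := f (w + s) - f w with hg
  have hgradH : ⟪gradient Hn (w + s + d), d⟫ = ⟪h (w + s + d), d⟫ + 1 / δt * (2 * ‖d‖ ^ 2) := by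
    have hderiv := (hH (w + s + d)).hasFDerivAt.fun_add
      ((hasFDerivAt_norm_sub_sq (w + s) (w + s + d)).const_mul (1 / δt))
    rw [inner_gradient_left, funext hHn, hderiv.fderiv]
    simp
  have hgradF : ⟪gradient Fn (w + s), d⟫
      = 1 / (3 * δt) * (2 * ⟪s, d⟫) - ⟪f (w + s), d⟫ - ⟪g, d⟫ := by
    have hderiv := (((hasFDerivAt_norm_sub_sq w (w + s)).const_mul (1 / (3 * δt))).fun_sub
      (hF (w + s)).hasFDerivAt).fun_sub
      ((innerSL ℝ g).hasFDerivAt.comp (w + s) ((hasFDerivAt_id (w + s)).sub_const w))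
    rw [inner_gradient_left, funext hFn]
    refine (congrArg (· d) hderiv.fderiv).trans ?_
    simp
  have hoptd := congrArg (fun v => ⟪v, d⟫) hopt
  simp only [inner_add_left, inner_sub_left, add_sub_cancel_left, inner_zero_left,
    hgradH, hgradF] at hoptd
  have hMd := hMpsd d
  have hHle := hHconv.add_inner_le_of_hasGradientAt (hH (w + s + d)) (w + s)
  have hFle := le_add_inner_add_of_lipschitz_gradient hF hLip (w + s) (w + s + d)
  have hgnorm : ‖g‖ ≤ L * ‖s‖ := by simpa [hg] using hLip (w + s) w
  obtain ⟨e, he⟩ : ∃ e, e = (1 + lamn) • d := ⟨_, rfl⟩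
  have hnext : unp1 = w + s + e := by
    rw [hupd, he, add_sub_cancel_left, add_smul, one_smul, ← add_assoc]
  rw [← hupd, hnext] at hls
  have hw (v : X) : w + s + v - w = s + v := by abel
  simp only [hEn, hHn, hFn, add_sub_cancel_left, hw, inner_add_right,
    norm_add_sq_real] at hls
  rw [hnext]
  simp only [hAfun, hE, add_sub_cancel_left]
  have hcoef : (α * lamn + 4 / (3 * δt) - L / 2) / (1 + lamn) ^ 2 * ‖e‖ ^ 2
      = (α * lamn + 4 / (3 * δt) - L / 2) * ‖d‖ ^ 2 := by
    rw [he, norm_smul, mul_pow, Real.norm_eq_abs, sq_abs]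
    field_simp
  have hge : -(L / 2 * (‖s‖ ^ 2 + ‖e‖ ^ 2)) ≤ ⟪g, e⟫ := by
    have hinner := neg_le_of_abs_le (abs_real_inner_le_norm g e)
    have hmul := mul_le_mul_of_nonneg_right hgnorm (norm_nonneg e)
    nlinarith [mul_nonneg hL.le (sq_nonneg (‖s‖ - ‖e‖))]
  have hdiff : 0 ≤ 1 / (3 * δt) * (‖s‖ ^ 2 - 2 * ⟪s, e⟫ + ‖e‖ ^ 2) := by
    rw [← norm_sub_sq_real]
    positivity
  have hneg : w + s - (w + s + d) = -d := by abel
  rw [hneg, inner_neg_right] at hHle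
  rw [add_sub_cancel_left] at hFle
  have hD3 : 1 / δt = 3 * (1 / (3 * δt)) := by field_simp
  have hD4 : 4 / (3 * δt) = 4 * (1 / (3 * δt)) := by ring
  rw [sub_mul, hcoef, hD4]
  rw [hD3] at hls hoptd
  linarith
end

section
/- Under the same algorithmic setting (û^n = u^n, descent line search with parameter α > 0, λ_max < √(4/(3 δt L) − 1/2) − 1, h and f Lipschitz, E level-bounded), suppose additionally that A(x,y) = E(x) + (L/2 + 1/(3δt))‖x − y‖² satisfies the Kurdyka–Łojasiewicz property at every critical point. Then the sequence (u^n)_n has finite length, ∑_{n=0}^∞ ‖u^{n+1} − u^n‖ < ∞, and (u^n)_n converges to a critical point u* of E, i.e., ∇E(u*) = h(u*) + f(u*) = 0. -/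
open scoped RealInnerProductSpace
open Filter Topology

/-- A differentiable function `g` satisfies the Kurdyka–Łojasiewicz property at a critical
point `xbar`: there exist `ν > 0`, a neighborhood `O` of `xbar`, and a continuous concave
desingularizing function `ψ : [0, ν) → [0, ∞)` with `ψ 0 = 0`, continuously differentiable
with `ψ' > 0` on `(0, ν)`, such that `ψ'(g x - g xbar) ‖∇g x‖ ≥ 1` for all `x ∈ O` with
`g xbar < g x < g xbar + ν`. -/
def KLPropertyAt {Y : Type*} [NormedAddCommGroup Y] [InnerProductSpace ℝ Y]
    [CompleteSpace Y] (g : Y → ℝ) (xbar : Y) : Prop :=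
  ∃ ν : ℝ, 0 < ν ∧ ∃ O ∈ 𝓝 xbar, ∃ ψ ψ' : ℝ → ℝ,
    ContinuousOn ψ (Set.Ico 0 ν) ∧ ψ 0 = 0 ∧ (∀ s ∈ Set.Ico (0 : ℝ) ν, 0 ≤ ψ s) ∧
    ConcaveOn ℝ (Set.Ico 0 ν) ψ ∧
    (∀ s ∈ Set.Ioo (0 : ℝ) ν, HasDerivAt ψ (ψ' s) s ∧ 0 < ψ' s) ∧
    ContinuousOn ψ' (Set.Ioo 0 ν) ∧
    ∀ x ∈ O, g xbar < g x → g x < g xbar + ν → 1 ≤ ψ' (g x - g xbar) * ‖gradient g x‖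

section Calculus

variable {X : Type*} [NormedAddCommGroup X] [InnerProductSpace ℝ X] [CompleteSpace X]

lemma HasGradientAt.hasDerivAt_line {F : X → ℝ} {g x d : X} {t : ℝ}
    (hF : HasGradientAt F g (x + t • d)) :
    HasDerivAt (fun s : ℝ => F (x + s • d)) ⟪g, d⟫ t := by
  have hline : HasDerivAt (fun s : ℝ => x + s • d) d t := by
    simpa using ((hasDerivAt_id t).smul_const d).const_add x
  simpa [Function.comp_def] using hF.hasFDerivAt.comp_hasDerivAt t hline

/-- The descent lemma: a function with `L`-Lipschitz gradient lies below its quadratic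
upper model. -/
lemma le_add_inner_gradient_add_sq {F : X → ℝ} {f : X → X}
    (hF : ∀ x, HasGradientAt F (f x) x) {L : ℝ}
    (hLip : ∀ x y, ‖f x - f y‖ ≤ L * ‖x - y‖) (x d : X) :
    F (x + d) ≤ F x + ⟪f x, d⟫ + L / 2 * ‖d‖ ^ 2 := by
  let φ : ℝ → ℝ := fun t => F (x + t • d) - t * ⟪f x, d⟫ - L / 2 * t ^ 2 * ‖d‖ ^ 2
  have hφ : ∀ t, HasDerivAt φ (⟪f (x + t • d), d⟫ - ⟪f x, d⟫ - L * t * ‖d‖ ^ 2) t := by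
    intro t
    have h₁ := ((hF (x + t • d)).hasDerivAt_line.sub
      ((hasDerivAt_id t).mul_const ⟪f x, d⟫)).sub
      ((((hasDerivAt_id t).pow 2).const_mul (L / 2)).mul_const (‖d‖ ^ 2))
    refine h₁.congr_deriv ?_
    simp only [id_eq, Nat.cast_ofNat, Nat.add_one_sub_one, pow_one]
    ring
  have hanti : AntitoneOn φ (Set.Icc 0 1) := by
    apply antitoneOn_of_deriv_nonpos (convex_Icc 0 1)
    · exact fun t _ => (hφ t).continuousAt.continuousWithinAt
    · exact fun t _ => (hφ t).differentiableAt.differentiableWithinAt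
    · intro t ht
      rw [interior_Icc] at ht
      rw [(hφ t).deriv, ← inner_sub_left]
      have h₁ := real_inner_le_norm (f (x + t • d) - f x) d
      have h₂ := hLip (x + t • d) x
      rw [add_sub_cancel_left, norm_smul, Real.norm_of_nonneg ht.1.le] at h₂
      nlinarith [mul_le_mul_of_nonneg_right h₂ (norm_nonneg d)]
  have := hanti (Set.left_mem_Icc.2 zero_le_one) (Set.right_mem_Icc.2 zero_le_one) zero_le_one
  simp only [φ, one_smul, zero_smul, add_zero] at this
  linarith

lemma ConvexOn.add_inner_gradient_le {H : X → ℝ} (hH : ConvexOn ℝ Set.univ H) {x g : X}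
    (hg : HasGradientAt H g x) (d : X) : H x + ⟪g, d⟫ ≤ H (x + d) := by
  have hconv : ConvexOn ℝ Set.univ (fun t : ℝ => H (x + t • d)) := by
    refine ⟨convex_univ, fun s _ t _ a b ha hb hab => ?_⟩
    convert hH.2 (Set.mem_univ (x + s • d)) (Set.mem_univ (x + t • d)) ha hb hab using 2
    rw [smul_add, smul_add, add_add_add_comm, ← add_smul, hab, one_smul, smul_smul, smul_smul,
      ← add_smul, smul_eq_mul, smul_eq_mul]
  have hderiv : HasDerivAt (fun t : ℝ => H (x + t • d)) ⟪g, d⟫ 0 :=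
    HasGradientAt.hasDerivAt_line (by simpa using hg)
  have := hconv.le_slope_of_hasDerivAt (Set.mem_univ 0) (Set.mem_univ 1) zero_lt_one hderiv
  simp [slope_def_field] at this
  linarith

lemma HasGradientAt.add {F G : X → ℝ} {f g x : X} (hF : HasGradientAt F f x)
    (hG : HasGradientAt G g x) : HasGradientAt (fun v => F v + G v) (f + g) x := by
  rw [hasGradientAt_iff_hasFDerivAt, map_add]
  exact hF.hasFDerivAt.add hG.hasFDerivAt

lemma HasGradientAt.const_mul {F : X → ℝ} {f x : X} (hF : HasGradientAt F f x) (c : ℝ) :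
    HasGradientAt (fun v => c * F v) (c • f) x := by
  rw [hasGradientAt_iff_hasFDerivAt, map_smulₛₗ]
  exact hF.hasFDerivAt.const_mul c

lemma hasGradientAt_norm_sub_sq (w x : X) :
    HasGradientAt (fun v => ‖v - w‖ ^ 2) ((2 : ℝ) • (x - w)) x := by
  rw [hasGradientAt_iff_hasFDerivAt]
  refine ((hasFDerivAt_id x).sub_const w).norm_sq.congr_fderiv ?_
  ext v
  simp [two_mul]

lemma hasGradientAt_inner_sub (g w x : X) :
    HasGradientAt (fun v => ⟪g, v - w⟫) g x := by
  rw [hasGradientAt_iff_hasFDerivAt]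
  refine ((innerSL ℝ g).hasFDerivAt.comp x ((hasFDerivAt_id x).sub_const w)).congr_fderiv ?_
  ext v
  simp

/-- The gradient of `(x, y) ↦ E x + κ ‖x - y‖ ^ 2` on the `L²` product. -/
lemma hasGradientAt_add_mul_norm_sub_sq {E : X → ℝ} {e : X} {p : WithLp 2 (X × X)}
    (hE : HasGradientAt E e p.fst) (κ : ℝ) :
    HasGradientAt (fun q : WithLp 2 (X × X) => E q.fst + κ * ‖q.fst - q.snd‖ ^ 2)
      (WithLp.toLp 2 (e + (2 * κ) • (p.fst - p.snd), -(2 * κ) • (p.fst - p.snd))) p := by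
  rw [hasGradientAt_iff_hasFDerivAt]
  have hfst := (WithLp.fstL 2 ℝ X X).hasFDerivAt (x := p)
  have hsnd := (WithLp.sndL 2 ℝ X X).hasFDerivAt (x := p)
  have h₁ := (HasFDerivAt.comp p (g := E) hE.hasFDerivAt hfst).add
    (((hfst.sub hsnd).norm_sq).const_mul κ)
  refine h₁.congr_fderiv ?_
  ext v
  simp [WithLp.prod_inner_apply, inner_add_left, inner_smul_left, inner_sub_left]
  ring

end Calculus

section FiniteLength

lemma ConcaveOn.mul_sub_le_sub {s : Set ℝ} {ψ : ℝ → ℝ} (hψ : ConcaveOn ℝ s ψ) {a b ψ' : ℝ}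
    (hb : b ∈ s) (ha : a ∈ s) (hba : b ≤ a) (hd : HasDerivAt ψ ψ' a) :
    ψ' * (a - b) ≤ ψ a - ψ b := by
  rcases hba.eq_or_lt with rfl | hlt
  · simp
  · have := hψ.le_slope_of_hasDerivAt hb ha hlt hd
    rwa [slope_def_field, le_div_iff₀ (sub_pos.2 hlt)] at this

/-- The steps of a sequence tend to zero if their squares are controlled by the decrease of a
convergent sequence of values. -/
lemma tendsto_dist_zero_of_sufficient_decrease {X : Type*} [PseudoMetricSpace X] {u : ℕ → X}
    {G : ℕ → ℝ} {c l : ℝ} (hc : 0 < c)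
    (hdesc : ∀ n, G (n + 1) + c * dist (u (n + 1)) (u n) ^ 2 ≤ G n)
    (hlim : Tendsto G atTop (𝓝 l)) :
    Tendsto (fun n => dist (u (n + 1)) (u n)) atTop (𝓝 0) := by
  have h₁ : Tendsto (fun n => (G n - G (n + 1)) / c) atTop (𝓝 0) := by
    simpa using (hlim.sub ((tendsto_add_atTop_iff_nat 1).2 hlim)).div_const c
  have h₂ : Tendsto (fun n => dist (u (n + 1)) (u n) ^ 2) atTop (𝓝 0) :=
    squeeze_zero (fun n => sq_nonneg _)
      (fun n => by rw [le_div_iff₀ hc]; linarith [hdesc n]) h₁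
  simpa using h₂.sqrt

/-- If consecutive distances satisfy a perturbed contraction as long as the sequence stays near
one of its cluster points, then they are summable. -/
lemma summable_dist_of_contraction_near_clusterPt {X : Type*} [PseudoMetricSpace X]
    {u : ℕ → X} {p : ℕ → ℝ} {x : X} {ρ : ℝ} (hρ : 0 < ρ) {N : ℕ}
    (hp0 : ∀ n ≥ N, 0 ≤ p n) (hp : Tendsto p atTop (𝓝 0))
    (hr : Tendsto (fun n => dist (u (n + 1)) (u n)) atTop (𝓝 0))
    (hx : MapClusterPt x atTop u)
    (hstep : ∀ n ≥ N, dist (u (n + 2)) x < ρ →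
      dist (u (n + 3)) (u (n + 2)) + p (n + 1)
        ≤ (dist (u (n + 2)) (u (n + 1)) + dist (u (n + 1)) (u n)) / 4 + p n) :
    Summable (fun n => dist (u (n + 1)) (u n)) := by
  set r : ℕ → ℝ := fun n => dist (u (n + 1)) (u n) with hr_def
  have hr0 : ∀ n, 0 ≤ r n := fun n => dist_nonneg
  obtain ⟨m, hmN, hmx, hmB⟩ : ∃ m ≥ N, dist (u (m + 2)) x < ρ / 2 ∧
      r (m + 1) + r m / 2 + 2 * p m < ρ / 2 := by
    have hlim : Tendsto (fun n => r (n + 1) + r n / 2 + 2 * p n) atTop (𝓝 0) := by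
      simpa using (((tendsto_add_atTop_iff_nat 1).2 hr).add (hr.div_const 2)).add
        (hp.const_mul 2)
    obtain ⟨N₁, hN₁⟩ := eventually_atTop.1 (hlim.eventually (gt_mem_nhds (half_pos hρ)))
    obtain ⟨k, hk, hkx⟩ := (frequently_atTop.1
      (hx.frequently (Metric.ball_mem_nhds x (half_pos hρ)))) (max N N₁ + 2)
    refine ⟨k - 2, by omega, ?_, hN₁ _ (by omega)⟩
    rwa [show k - 2 + 2 = k by omega]
  have hdist : ∀ k, dist (u (m + 2 + k)) (u (m + 2)) ≤ ∑ i ∈ Finset.range k, r (m + 2 + i) := by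
    intro k
    rw [dist_comm]
    convert dist_le_range_sum_dist (fun i => u (m + 2 + i)) k using 2 with i
    exact dist_comm _ _
  have hinv : ∀ k, (∑ i ∈ Finset.range k, r (m + 2 + i)) / 2 + r (m + k + 1) / 2
      + r (m + k) / 4 + p (m + k) ≤ (r (m + 1) + r m / 2 + 2 * p m) / 2 := by
    intro k
    induction k with
    | zero => simp; linarith
    | succ k ih =>
      have hnear : dist (u (m + k + 2)) x < ρ := by
        have h₁ := dist_triangle (u (m + 2 + k)) (u (m + 2)) x
        have h₂ := hdist k
        have h₃ := hp0 (m + k) (by omega)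
        rw [show m + k + 2 = m + 2 + k by ring]
        linarith [hr0 (m + k + 1), hr0 (m + k)]
      have hs : r (m + k + 2) + p (m + k + 1) ≤ (r (m + k + 1) + r (m + k)) / 4 + p (m + k) :=
        hstep (m + k) (by omega) hnear
      rw [Finset.sum_range_succ, show m + 2 + k = m + k + 2 by ring, ← add_assoc m k 1,
        show m + k + 1 + 1 = m + k + 2 by ring]
      linarith
  rw [← summable_nat_add_iff (m + 2)]
  refine summable_of_sum_range_le (c := ρ / 2) (fun n => hr0 _) fun k => ?_
  have := hinv k
  simp only [add_comm _ (m + 2)]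
  linarith [hp0 (m + k) (by omega), hr0 (m + k + 1), hr0 (m + k)]

/-- Finite length of a descent sequence for a function with the Kurdyka–Łojasiewicz property,
where the gradient is controlled by the two most recent steps. -/
lemma KLPropertyAt.summable_dist {X Y : Type*} [PseudoMetricSpace X] [NormedAddCommGroup Y]
    [InnerProductSpace ℝ Y] [CompleteSpace Y] {g : Y → ℝ} {zbar : Y} (hKL : KLPropertyAt g zbar)
    {u : ℕ → X} {z : ℕ → Y} {x : X} {c C : ℝ} (hc : 0 < c) (hC : 0 < C)
    (hdesc : ∀ n, g (z (n + 1)) + c * dist (u (n + 1)) (u n) ^ 2 ≤ g (z n))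
    (hgrad : ∀ n, ‖gradient g (z (n + 2))‖
      ≤ C * (dist (u (n + 2)) (u (n + 1)) + dist (u (n + 1)) (u n)))
    (hlim : Tendsto (fun n => g (z n)) atTop (𝓝 (g zbar)))
    (hx : MapClusterPt x atTop u)
    (hz : Tendsto z (atTop ⊓ comap u (𝓝 x)) (𝓝 zbar)) :
    Summable (fun n => dist (u (n + 1)) (u n)) := by
  have hanti : Antitone (fun n => g (z n)) :=
    antitone_nat_of_succ_le fun n => by nlinarith [hdesc n, sq_nonneg (dist (u (n + 1)) (u n))]
  have hge : ∀ n, g zbar ≤ g (z n) := fun n => hanti.le_of_tendsto hlim n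
  have hr := tendsto_dist_zero_of_sufficient_decrease hc hdesc hlim
  by_cases hfin : ∃ N, g (z N) = g zbar
  · obtain ⟨N, hN⟩ := hfin
    refine summable_of_ne_finset_zero (s := Finset.range N) fun n hn => ?_
    have hn' : N ≤ n := by simpa using hn
    have h₁ : g (z n) ≤ g (z N) := hanti hn'
    have h₂ : c * dist (u (n + 1)) (u n) ^ 2 ≤ 0 := by linarith [hdesc n, hge (n + 1)]
    have h₃ : dist (u (n + 1)) (u n) ^ 2 ≤ 0 := nonpos_of_mul_nonpos_right h₂ hc
    exact pow_eq_zero_iff two_ne_zero |>.1 (h₃.antisymm (sq_nonneg _))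
  push Not at hfin
  have hgt : ∀ n, g zbar < g (z n) := fun n => (hge n).lt_of_ne (hfin n).symm
  obtain ⟨ν, hν, O, hO, ψ, ψ', hψc, hψ0, hψnn, hψconc, hψd, -, hKL⟩ := hKL
  obtain ⟨N, hN⟩ := eventually_atTop.1
    (hlim.eventually (gt_mem_nhds (lt_add_of_pos_right (g zbar) hν)))
  obtain ⟨ρ, hρ, N', hN'⟩ : ∃ ρ > 0, ∃ N', ∀ n ≥ N', dist (u n) x < ρ → z n ∈ O := by
    have h₁ := hz hO
    rw [mem_map, mem_inf_iff_superset] at h₁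
    obtain ⟨s, hs, t, ht, hst⟩ := h₁
    obtain ⟨N', hN'⟩ := mem_atTop_sets.1 hs
    obtain ⟨t', ht', htt'⟩ := mem_comap.1 ht
    obtain ⟨ρ, hρ, hball⟩ := Metric.mem_nhds_iff.1 ht'
    exact ⟨ρ, hρ, N', fun n hn hd => hst ⟨hN' n hn, htt' (hball hd)⟩⟩
  have hmem : ∀ n ≥ N, g (z n) - g zbar ∈ Set.Ioo 0 ν := fun n hn =>
    ⟨sub_pos.2 (hgt n), by linarith [hN n hn]⟩
  have hK : 0 < C / c := div_pos hC hc
  refine summable_dist_of_contraction_near_clusterPt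
    (p := fun n => C / c * ψ (g (z (n + 2)) - g zbar)) hρ (N := max N N') ?_ ?_ hr hx ?_
  · intro n hn
    exact mul_nonneg hK.le (hψnn _ (Set.Ioo_subset_Ico_self (hmem _ (by omega))))
  · have h₁ : Tendsto (fun n => g (z (n + 2)) - g zbar) atTop (𝓝[Set.Ico 0 ν] 0) := by
      refine tendsto_nhdsWithin_iff.2 ⟨?_, eventually_atTop.2 ⟨N, fun n hn =>
        Set.Ioo_subset_Ico_self (hmem _ (by omega))⟩⟩
      simpa using ((tendsto_add_atTop_iff_nat 2).2 hlim).sub_const (g zbar)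
    have h₂ := (hψc 0 (Set.left_mem_Ico.2 hν)).tendsto.comp h₁
    rw [hψ0] at h₂
    simpa using h₂.const_mul (C / c)
  · intro n hn hnear
    have ha := hmem (n + 2) (by omega)
    have hb := hmem (n + 3) (by omega)
    have hkl := hKL _ (hN' (n + 2) (by omega) hnear) (hgt _) (hN _ (by omega))
    have hconc := hψconc.mul_sub_le_sub (Set.Ioo_subset_Ico_self hb) (Set.Ioo_subset_Ico_self ha)
      (sub_le_sub_right (hanti (Nat.le_succ (n + 2))) _) (hψd _ ha).1
    have hpos := (hψd _ ha).2
    have hd := hdesc (n + 2)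
    have hg := hgrad n
    simp only [add_assoc, Nat.reduceAdd] at hd hconc ⊢
    set a := g (z (n + 2)) - g zbar
    set b := g (z (n + 3)) - g zbar
    set s := dist (u (n + 3)) (u (n + 2))
    set q := dist (u (n + 2)) (u (n + 1)) + dist (u (n + 1)) (u n) with hq
    have hq0 : 0 ≤ q := by positivity
    have hs0 : 0 ≤ s := dist_nonneg
    have hone : 1 ≤ ψ' a * (C * q) := hkl.trans (mul_le_mul_of_nonneg_left hg hpos.le)
    have hcs : ψ' a * (c * s ^ 2) ≤ ψ a - ψ b :=
      (mul_le_mul_of_nonneg_left (by linarith) hpos.le).trans hconc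
    set D := C / c * (ψ a - ψ b) with hD
    have hsq : s ^ 2 ≤ q * D := by
      have h₁ : C * q * (ψ' a * (c * s ^ 2)) ≤ C * q * (ψ a - ψ b) :=
        mul_le_mul_of_nonneg_left hcs (by positivity)
      have h₂ : c * s ^ 2 ≤ C * q * (ψ a - ψ b) := by
        nlinarith [mul_le_mul_of_nonneg_right hone (by positivity : 0 ≤ c * s ^ 2)]
      have h₃ : q * D = C * q * (ψ a - ψ b) / c := by rw [hD]; ring
      rw [h₃, le_div_iff₀ hc]
      linarith
    have hD0 : 0 ≤ D := mul_nonneg hK.le (le_trans (by positivity) hcs)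
    have hfinal : s ≤ q / 4 + D := by
      apply le_of_sq_le_sq _ (by positivity)
      nlinarith [sq_nonneg (q / 4 - D)]
    rw [hD] at hfinal
    linarith

end FiniteLength

section Algorithm

variable {X : Type*} [NormedAddCommGroup X] [InnerProductSpace ℝ X]
  {H F : X → ℝ} {h f : X → X} {L : ℝ} {M : X →L[ℝ] X}

/-- The residual `h + f` after one step is controlled by the two most recent steps. -/
lemma norm_residual_le {Lh : ℝ} (hLh : 0 ≤ Lh) (hhLip : ∀ x y, ‖h x - h y‖ ≤ Lh * ‖x - y‖)
    (hLip : ∀ x y, ‖f x - f y‖ ≤ L * ‖x - y‖) {a l : ℝ} (ha : 0 < a)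
    (hl : 0 ≤ l) {w v y v' : X}
    (hopt : h y + (2 * a) • (y - v) - ((2 * a / 3) • (v - w) - f v - (f v - f w))
      + M (y - v) = 0)
    (hv' : v' = y + l • (y - v)) :
    ‖h v' + f v'‖ ≤ (Lh + L + 2 * a + ‖M‖) * (‖v' - v‖ + ‖v - w‖) := by
  have hs : ‖v' - v‖ = (1 + l) * ‖y - v‖ := by
    rw [hv', show y + l • (y - v) - v = (1 + l) • (y - v) by module, norm_smul,
      Real.norm_of_nonneg (by linarith)]
  have hvy : ‖v' - y‖ = l * ‖y - v‖ := by
    rw [hv', add_sub_cancel_left, norm_smul, Real.norm_of_nonneg hl]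
  have hd : ‖y - v‖ ≤ ‖v' - v‖ := by nlinarith [norm_nonneg (y - v)]
  have hvy' : ‖v' - y‖ ≤ ‖v' - v‖ := by nlinarith [norm_nonneg (y - v)]
  have hdecomp : h v' + f v' = (h v' - h y) + (f v' - f v) - (2 * a) • (y - v)
      + (2 * a / 3) • (v - w) - (f v - f w) - M (y - v) := by
    rw [← sub_eq_zero, ← hopt]
    abel
  have hnorm : ‖h v' + f v'‖ ≤ ‖h v' - h y‖ + ‖f v' - f v‖ + ‖(2 * a) • (y - v)‖
      + ‖(2 * a / 3) • (v - w)‖ + ‖f v - f w‖ + ‖M (y - v)‖ := by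
    rw [hdecomp]
    refine (norm_sub_le _ _).trans (add_le_add_left ?_ _)
    refine (norm_sub_le _ _).trans (add_le_add_left ?_ _)
    refine (norm_add_le _ _).trans (add_le_add_left ?_ _)
    exact (norm_sub_le _ _).trans (add_le_add_left (norm_add_le _ _) _)
  rw [norm_smul, norm_smul, Real.norm_of_nonneg (by positivity : 0 ≤ 2 * a),
    Real.norm_of_nonneg (by positivity : 0 ≤ 2 * a / 3)] at hnorm
  have h₁ := (hhLip v' y).trans (mul_le_mul_of_nonneg_left hvy' hLh)
  have h₂ := hLip v' v
  have h₃ := mul_le_mul_of_nonneg_left hd (by positivity : 0 ≤ 2 * a)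
  have h₄ := hLip v w
  have h₅ := (M.le_opNorm (y - v)).trans (mul_le_mul_of_nonneg_left hd (norm_nonneg M))
  have h₆ : 0 ≤ (Lh + 4 * a / 3 + ‖M‖) * ‖v - w‖ := by positivity
  linarith

variable [CompleteSpace X]

/-- One step of the algorithm, from the iterates `w`, `v` to `y + l • (y - v)`, decreases the
auxiliary energy `E x + (L / 2 + a / 3) ‖x - y‖ ^ 2`, where `a` is the inverse step size. -/
lemma auxiliary_energy_decrease (hH : ∀ x, HasGradientAt H (h x) x)
    (hHconv : ConvexOn ℝ Set.univ H) (hF : ∀ x, HasGradientAt F (f x) x)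
    (hLip : ∀ x y, ‖f x - f y‖ ≤ L * ‖x - y‖) (hMpsd : ∀ x, 0 ≤ ⟪M x, x⟫)
    {a α l Λ c : ℝ} (ha : 0 < a) (hα : 0 < α) (hl : 0 ≤ l) (hlΛ : l ≤ Λ) (hL : 0 ≤ L)
    (hc : 0 ≤ c) (hcΛ : (L + c) * (1 + Λ) ^ 2 ≤ 4 * a / 3 - L / 2) {w v y v' : X}
    (hopt : h y + (2 * a) • (y - v) - ((2 * a / 3) • (v - w) - f v - (f v - f w))
      + M (y - v) = 0)
    (hv' : v' = y + l • (y - v))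
    (hls : H v' + a * ‖v' - v‖ ^ 2 - (a / 3 * ‖v' - w‖ ^ 2 - F v' - ⟪f v - f w, v' - w⟫)
      ≤ H y + a * ‖y - v‖ ^ 2 - (a / 3 * ‖y - w‖ ^ 2 - F y - ⟪f v - f w, y - w⟫)
        - α * l * ‖y - v‖ ^ 2) :
    H v' + F v' + (L / 2 + a / 3) * ‖v' - v‖ ^ 2 + c * ‖v' - v‖ ^ 2
      ≤ H v + F v + (L / 2 + a / 3) * ‖v - w‖ ^ 2 := by
  obtain ⟨d, rfl⟩ : ∃ d, y = v + d := ⟨y - v, by abel⟩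
  obtain ⟨e, rfl⟩ : ∃ e, v = w + e := ⟨v - w, by abel⟩
  have e₁ : v' - (w + e) = (1 + l) • d := by rw [hv']; module
  have e₂ : v' - w = (1 + l) • d + e := by rw [hv']; module
  have e₃ : w + e + d - w = d + e := by abel
  have n₁ : ‖(1 + l) • d‖ ^ 2 = (1 + l) ^ 2 * ‖d‖ ^ 2 := by
    rw [norm_smul, mul_pow, Real.norm_eq_abs, sq_abs]
  have hconv := hHconv.add_inner_gradient_le (hH (w + e + d)) (-d)
  have hdesc := le_add_inner_gradient_add_sq hF hLip (w + e) d
  have hinner := congrArg (fun x => ⟪x, d⟫) hopt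
  simp only [add_sub_cancel_left, inner_add_left, inner_sub_left, inner_smul_left, inner_zero_left,
    real_inner_self_eq_norm_sq, conj_trivial, real_inner_comm d e] at hinner
  rw [e₁, e₂, e₃, norm_add_sq_real, norm_add_sq_real d e, inner_add_right, inner_add_right,
    n₁, real_inner_smul_left, real_inner_smul_right] at hls
  rw [e₁, n₁]
  simp only [add_sub_cancel_left, inner_neg_right, add_neg_cancel_right, inner_sub_left]
    at hls hconv ⊢
  have hcross : 2 * ((1 + l) * ⟪d, e⟫) ≤ (1 + l) ^ 2 * ‖d‖ ^ 2 + ‖e‖ ^ 2 := by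
    have := sq_nonneg ‖(1 + l) • d - e‖
    rw [norm_sub_sq_real, n₁, real_inner_smul_left] at this
    linarith
  have hΔ : -((1 + l) * (⟪f (w + e), d⟫ - ⟪f w, d⟫))
      ≤ L / 2 * ((1 + l) ^ 2 * ‖d‖ ^ 2 + ‖e‖ ^ 2) := by
    have h₁ := hLip (w + e) w
    rw [add_sub_cancel_left] at h₁
    have h₂ := neg_le_of_abs_le (abs_real_inner_le_norm (f (w + e) - f w) ((1 + l) • d))
    rw [real_inner_smul_right, inner_sub_left] at h₂
    have h₃ := mul_le_mul_of_nonneg_right h₁ (norm_nonneg ((1 + l) • d))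
    have h₄ := mul_nonneg hL (sq_nonneg (‖(1 + l) • d‖ - ‖e‖))
    rw [← n₁]
    linarith
  have hstep : (L + c) * ((1 + l) ^ 2 * ‖d‖ ^ 2) ≤ (4 * a / 3 - L / 2) * ‖d‖ ^ 2 := by
    rw [← mul_assoc]
    refine mul_le_mul_of_nonneg_right (le_trans ?_ hcΛ) (sq_nonneg _)
    gcongr
  have hαl : 0 ≤ α * l * ‖d‖ ^ 2 := by positivity
  have hM := hMpsd d
  have hcross' := mul_le_mul_of_nonneg_left hcross (by positivity : 0 ≤ a / 3)
  linarith

end Algorithm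

/-- Global convergence of the algorithm with `ûⁿ = uⁿ`: if the auxiliary
function `A(x,y) = E(x) + (L/2 + 1/(3δt))‖x - y‖²` has the KL property at each of its
critical points, then the iterates have finite length and converge to a critical point of
`E`. -/
theorem global_convergence_un
    {X : Type*} [NormedAddCommGroup X] [InnerProductSpace ℝ X] [FiniteDimensional ℝ X]
    (H : X → ℝ) (h : X → X) (hH : ∀ x : X, HasGradientAt H (h x) x)
    (hHconv : ConvexOn ℝ Set.univ H)
    (F : X → ℝ) (f : X → X) (hF : ∀ x : X, HasGradientAt F (f x) x)
    (L : ℝ) (hL : 0 < L) (hLip : ∀ x y : X, ‖f x - f y‖ ≤ L * ‖x - y‖)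
    (Lh : ℝ) (hLh : 0 ≤ Lh) (hhLip : ∀ x y : X, ‖h x - h y‖ ≤ Lh * ‖x - y‖)
    (δt : ℝ) (hδt : 0 < δt) (hδt2 : δt < 2 / (3 * L))
    (M : X →L[ℝ] X) (hMsym : ∀ x y : X, ⟪M x, y⟫ = ⟪x, M y⟫)
    (hMpsd : ∀ x : X, 0 ≤ ⟪M x, x⟫)
    (u y : ℕ → X) (lam : ℕ → ℝ) (α : ℝ) (hα : 0 < α)
    (Hn Fn En : ℕ → X → ℝ)
    (hHn : ∀ n : ℕ, ∀ v : X, Hn n v = H v + (1 / δt) * ‖v - u n‖ ^ 2)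
    (hFn : ∀ n : ℕ, ∀ v : X, Fn n v = (1 / (3 * δt)) * ‖v - u (n - 1)‖ ^ 2 - F v
      - ⟪f (u n) - f (u (n - 1)), v - u (n - 1)⟫)
    (hEn : ∀ n : ℕ, ∀ v : X, En n v = Hn n v - Fn n v)
    (hopt : ∀ n : ℕ, gradient (Hn n) (y n) - gradient (Fn n) (u n) + M (y n - u n) = 0)
    (hlam0 : ∀ n : ℕ, 0 ≤ lam n)
    (hls : ∀ n : ℕ, En n (y n + lam n • (y n - u n))
      ≤ En n (y n) - α * lam n * ‖y n - u n‖ ^ 2)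
    (hupd : ∀ n : ℕ, u (n + 1) = y n + lam n • (y n - u n))
    (E : X → ℝ) (hE : ∀ v : X, E v = H v + F v)
    (hlevel : ∀ c : ℝ, Bornology.IsBounded {x : X | E x ≤ c})
    (lamMax : ℝ) (hlamMax : ∀ n : ℕ, lam n ≤ lamMax)
    (hlamBound : lamMax < Real.sqrt (4 / (3 * δt * L) - 1 / 2) - 1)
    (Afun : WithLp 2 (X × X) → ℝ)
    (hAfun : ∀ p : WithLp 2 (X × X),
      Afun p = E (WithLp.equiv 2 (X × X) p).1
        + (L / 2 + 1 / (3 * δt))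
          * ‖(WithLp.equiv 2 (X × X) p).1 - (WithLp.equiv 2 (X × X) p).2‖ ^ 2)
    (hKL : ∀ p : WithLp 2 (X × X), gradient Afun p = 0 → KLPropertyAt Afun p) :
    Summable (fun n : ℕ => ‖u (n + 1) - u n‖) ∧
    ∃ ustar : X, Tendsto u atTop (𝓝 ustar) ∧ h ustar + f ustar = 0 := by
  set a : ℝ := 1 / δt with ha_def
  have ha : 0 < a := by positivity
  have ha3 : 1 / (3 * δt) = a / 3 := by rw [ha_def]; field_simp
  set κ : ℝ := L / 2 + a / 3 with hκ_def
  have hκ : 0 < κ := by positivity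
  have hopt' : ∀ n, h (y n) + (2 * a) • (y n - u n) - ((2 * a / 3) • (u n - u (n - 1))
      - f (u n) - (f (u n) - f (u (n - 1)))) + M (y n - u n) = 0 := by
    intro n
    have h₁ : HasGradientAt (Hn n) (h (y n) + a • (2 : ℝ) • (y n - u n)) (y n) := by
      rw [funext (hHn n)]
      exact (hH _).add ((hasGradientAt_norm_sub_sq _ _).const_mul _)
    have h₂ : HasGradientAt (Fn n) ((a / 3) • (2 : ℝ) • (u n - u (n - 1)) + (-1 : ℝ) • f (u n)
        + (-1 : ℝ) • (f (u n) - f (u (n - 1)))) (u n) := by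
      have h₃ := ((((hasGradientAt_norm_sub_sq (u (n - 1)) (u n)).const_mul (a / 3)).add
        ((hF (u n)).const_mul (-1))).add
        ((hasGradientAt_inner_sub (f (u n) - f (u (n - 1))) (u (n - 1)) (u n)).const_mul (-1)))
      convert h₃ using 1
      funext v
      rw [hFn, ha3]
      ring
    have h₃ := hopt n
    rw [h₁.gradient, h₂.gradient] at h₃
    rw [← h₃]
    module
  have hΛ0 : 0 < 1 + lamMax := by linarith [hlam0 0, hlamMax 0]
  obtain ⟨c, hc, hcΛ⟩ : ∃ c > 0, (L + c) * (1 + lamMax) ^ 2 ≤ 4 * a / 3 - L / 2 := by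
    have h₁ : (1 + lamMax) ^ 2 < 4 / (3 * δt * L) - 1 / 2 :=
      (Real.lt_sqrt hΛ0.le).1 (by linarith)
    have h₂ : L * (1 + lamMax) ^ 2 < 4 * a / 3 - L / 2 := by
      have h₃ := mul_lt_mul_of_pos_left h₁ hL
      have h₄ : L * (4 / (3 * δt * L) - 1 / 2) = 4 * a / 3 - L / 2 := by
        rw [ha_def]; field_simp
      linarith
    refine ⟨(4 * a / 3 - L / 2 - L * (1 + lamMax) ^ 2) / (1 + lamMax) ^ 2,
      div_pos (by linarith) (by positivity), le_of_eq ?_⟩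
    field_simp
    ring
  have hAeq : Afun = fun q => E q.fst + κ * ‖q.fst - q.snd‖ ^ 2 := by
    funext q
    rw [hAfun, ha3]
    rfl
  have hgradE : ∀ x, HasGradientAt E (h x + f x) x := fun x => by
    rw [funext hE]
    exact (hH x).add (hF x)
  have hgradA : ∀ q : WithLp 2 (X × X), gradient Afun q = WithLp.toLp 2
      (h q.fst + f q.fst + (2 * κ) • (q.fst - q.snd), -(2 * κ) • (q.fst - q.snd)) := fun q => by
    rw [hAeq]
    exact (hasGradientAt_add_mul_norm_sub_sq (hgradE q.fst) κ).gradient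
  let z : ℕ → WithLp 2 (X × X) := fun n => WithLp.toLp 2 (u n, u (n - 1))
  have hdesc : ∀ n, Afun (z (n + 1)) + c * dist (u (n + 1)) (u n) ^ 2 ≤ Afun (z n) := by
    intro n
    have h₁ := hls n
    rw [← hupd n] at h₁
    simp only [hEn, hHn, hFn, ha3] at h₁
    have h₂ := auxiliary_energy_decrease hH hHconv hF hLip hMpsd ha hα (hlam0 n) (hlamMax n)
      hL.le hc.le hcΛ (hopt' n) (hupd n) h₁
    simp only [hAeq, z, hE, add_tsub_cancel_right, dist_eq_norm]
    exact h₂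
  have hres : ∀ n, ‖h (u (n + 2)) + f (u (n + 2))‖ ≤ (Lh + L + 2 * a + ‖M‖)
      * (dist (u (n + 2)) (u (n + 1)) + dist (u (n + 1)) (u n)) := by
    intro n
    simp only [dist_eq_norm]
    exact norm_residual_le hLh hhLip hLip ha (hlam0 (n + 1)) (hopt' (n + 1)) (hupd (n + 1))
  have hgrad : ∀ n, ‖gradient Afun (z (n + 2))‖ ≤ (Lh + L + 2 * a + ‖M‖ + 4 * κ)
      * (dist (u (n + 2)) (u (n + 1)) + dist (u (n + 1)) (u n)) := by
    intro n
    set s := u (n + 2) - u (n + 1) with hs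
    have h₁ : ‖gradient Afun (z (n + 2))‖
        ≤ ‖h (u (n + 2)) + f (u (n + 2)) + (2 * κ) • s‖ + ‖-(2 * κ) • s‖ := by
      rw [hgradA]
      refine abs_le_of_sq_le_sq' ?_ (by positivity) |>.2
      rw [WithLp.prod_norm_sq_eq_of_L2]
      simp only [z, WithLp.toLp_fst, WithLp.toLp_snd, show n + 2 - 1 = n + 1 by omega, ← hs]
      nlinarith [norm_nonneg (h (u (n + 2)) + f (u (n + 2)) + (2 * κ) • s),
        norm_nonneg (-(2 * κ) • s)]
    have h₂ := norm_add_le (h (u (n + 2)) + f (u (n + 2))) ((2 * κ) • s)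
    rw [neg_smul, norm_neg] at h₁
    have h₃ : ‖(2 * κ) • s‖ = 2 * κ * dist (u (n + 2)) (u (n + 1)) := by
      rw [norm_smul, Real.norm_of_nonneg (by positivity), dist_eq_norm]
    have h₄ : 0 ≤ 4 * κ * dist (u (n + 1)) (u n) := by positivity
    linarith [hres n]
  have hEcont : Continuous E :=
    continuous_iff_continuousAt.2 fun x => (hgradE x).continuousAt
  have hAcont : Continuous Afun := by
    rw [hAeq]
    exact (hEcont.comp (WithLp.fstL 2 ℝ X X).continuous).add (continuous_const.mul
      (((WithLp.fstL 2 ℝ X X).continuous.sub (WithLp.sndL 2 ℝ X X).continuous).norm.pow 2))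
  have hanti : Antitone (fun n => Afun (z n)) :=
    antitone_nat_of_succ_le fun n => by nlinarith [hdesc n, sq_nonneg (dist (u (n + 1)) (u n))]
  have hEA : ∀ n, E (u n) ≤ Afun (z n) := fun n => by
    simp only [hAeq, z, WithLp.toLp_fst, WithLp.toLp_snd]
    linarith [mul_nonneg hκ.le (sq_nonneg ‖u n - u (n - 1)‖)]
  have hbdd := hlevel (Afun (z 0))
  have hu : ∀ n, u n ∈ {x : X | E x ≤ Afun (z 0)} := fun n => (hEA n).trans (hanti n.zero_le)
  obtain ⟨l, hl⟩ : ∃ l, Tendsto (fun n => Afun (z n)) atTop (𝓝 l) := by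
    obtain ⟨b, hb⟩ := hbdd.isCompact_closure.bddBelow_image hEcont.continuousOn
    refine ⟨_, tendsto_atTop_ciInf hanti ⟨b, ?_⟩⟩
    rintro _ ⟨n, rfl⟩
    exact (hb (Set.mem_image_of_mem E (subset_closure (hu n)))).trans (hEA n)
  have hr := tendsto_dist_zero_of_sufficient_decrease hc hdesc hl
  obtain ⟨x, -, φ, hφ, hφx⟩ := tendsto_subseq_of_bounded hbdd hu
  have hz : Tendsto z (atTop ⊓ comap u (𝓝 x)) (𝓝 (WithLp.toLp 2 (x, x))) := by
    have h₁ : Tendsto u (atTop ⊓ comap u (𝓝 x)) (𝓝 x) := tendsto_comap.mono_left inf_le_right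
    have h₂ : Tendsto (fun n => dist (u n) (u (n - 1))) (atTop ⊓ comap u (𝓝 x)) (𝓝 0) := by
      refine Tendsto.mono_left ?_ inf_le_left
      rw [← tendsto_add_atTop_iff_nat 1]
      simpa using hr
    exact ((WithLp.prod_continuous_toLp 2 X X).tendsto (x, x)).comp
      (h₁.prodMk_nhds ((tendsto_iff_of_dist h₂).1 h₁))
  have hφ' : Tendsto φ atTop (atTop ⊓ comap u (𝓝 x)) :=
    tendsto_inf.2 ⟨hφ.tendsto_atTop, tendsto_comap_iff.2 hφx⟩
  have hlim : Tendsto (fun n => Afun (z n)) atTop (𝓝 (Afun (WithLp.toLp 2 (x, x)))) := by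
    have h₁ := (hAcont.tendsto _).comp (hz.comp hφ')
    rwa [← tendsto_nhds_unique (hl.comp hφ.tendsto_atTop) h₁]
  have hcrit : h x + f x = 0 := by
    have hcont : Continuous fun v => h v + f v :=
      (LipschitzWith.of_dist_le_mul (K := Lh.toNNReal) fun v w => by
        simpa [dist_eq_norm, hLh] using hhLip v w).continuous.add
      (LipschitzWith.of_dist_le_mul (K := L.toNNReal) fun v w => by
        simpa [dist_eq_norm, hL.le] using hLip v w).continuous
    have h₁ : Tendsto (fun n => h (u n) + f (u n)) atTop (𝓝 0) := by
      rw [← tendsto_add_atTop_iff_nat 2]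
      refine squeeze_zero_norm hres ?_
      simpa using (((tendsto_add_atTop_iff_nat 1).2 hr).add hr).const_mul
        (Lh + L + 2 * a + ‖M‖)
    exact tendsto_nhds_unique ((hcont.tendsto x).comp hφx) (h₁.comp hφ.tendsto_atTop)
  have hsum : Summable (fun n => dist (u (n + 1)) (u n)) := by
    have hKLx : KLPropertyAt Afun (WithLp.toLp 2 (x, x)) := by
      refine hKL _ ?_
      rw [hgradA]
      simp [hcrit]
    exact hKLx.summable_dist hc (by positivity) hdesc hgrad hlim
      (hφx.mapClusterPt.of_comp hφ.tendsto_atTop) hz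
  refine ⟨by simpa only [dist_eq_norm] using hsum, x, ?_, hcrit⟩
  refine tendsto_nhds_of_cauchySeq_of_subseq ?_ hφ.tendsto_atTop hφx
  exact cauchySeq_of_summable_dist (by simpa only [dist_comm] using hsum)
end
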